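/- arXiv:math/0202256 — 4 statements merged into one kernel-verified Lean document; each statement's English description precedes it below -/
import Mathlib

section
/- Let V be a finite-dimensional real vector space, ω an alternating bilinear form on V, W ⊆ V a subspace of codimension 1, K = ker ω and K_W = ker(ω|_W). Then exactly one of the following holds: (i) K ⊆ W, in which case K ⊆ K_W and dim K_W = dim K + 1; or (ii) K ⊄ W, in which case K_W = K ∩ W and dim K_W = dim K − 1. In particular one always has K ⊆ K_W or K_W ⊆ K. -/
open Module

/-- A subspace of codimension one together with any vector outside it spans the whole space. -/
theorem sup_span_singleton_eq_top_of_finrank_add_one {F V : Type*} [Field F] [AddCommGroup V]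
    [Module F V] [FiniteDimensional F V] {W : Submodule F V}
    (hW : finrank F W + 1 = finrank F V) {v : V} (hv : v ∉ W) : W ⊔ F ∙ v = ⊤ := by
  have hlt : W < W ⊔ F ∙ v := by
    simpa [left_lt_sup, Submodule.span_singleton_le_iff_mem] using hv
  have := Submodule.finrank_lt_finrank_of_lt hlt
  have := Submodule.finrank_le (W ⊔ F ∙ v)
  exact Submodule.eq_top_of_finrank_eq (by omega)

/-- A vector orthogonal to a hyperplane and to a vector outside it lies in the kernel. -/
theorem mem_ker_of_forall_mem_eq_zero {F V : Type*} [Field F] [AddCommGroup V]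
    [Module F V] [FiniteDimensional F V] (ω : V →ₗ[F] V →ₗ[F] F) {W : Submodule F V}
    (hW : finrank F W + 1 = finrank F V) {v x : V} (hv : v ∉ W)
    (hx : ∀ y ∈ W, ω x y = 0) (hxv : ω x v = 0) : x ∈ LinearMap.ker ω := by
  have hle : W ⊔ F ∙ v ≤ LinearMap.ker (ω x) :=
    sup_le hx ((Submodule.span_singleton_le_iff_mem _ _).2 hxv)
  rw [sup_span_singleton_eq_top_of_finrank_add_one hW hv, top_le_iff,
    LinearMap.ker_eq_top] at hle
  exact hle

/-- Dichotomy for the kernel of the restriction of an alternating bilinear form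
to a hyperplane: either the kernel K of ω is contained in W, in which case
K ⊆ ker(ω|_W) and the dimension goes up by one, or it is not, in which case
ker(ω|_W) = K ∩ W and the dimension goes down by one.  In particular one of the
two inclusions K ⊆ ker(ω|_W), ker(ω|_W) ⊆ K always holds. -/
theorem kernel_restriction_hyperplane_dichotomy
    {V : Type*} [AddCommGroup V] [Module ℝ V] [FiniteDimensional ℝ V]
    (ω : V →ₗ[ℝ] V →ₗ[ℝ] ℝ) (halt : ∀ x : V, ω x x = 0)
    (W : Submodule ℝ V) (hW : finrank ℝ W + 1 = finrank ℝ V)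
    (K : Submodule ℝ V) (hK : K = LinearMap.ker ω)
    (KW : Submodule ℝ V)
    (hKW : KW = (LinearMap.ker ((ω.domRestrict W).compl₂ W.subtype)).map W.subtype) :
    (Xor' (K ≤ W ∧ K ≤ KW ∧ finrank ℝ KW = finrank ℝ K + 1)
          (¬ K ≤ W ∧ KW = K ⊓ W ∧ finrank ℝ KW = finrank ℝ K - 1))
    ∧ (K ≤ KW ∨ KW ≤ K) := by
  have hω : ω.IsAlt := halt
  have hmem (x : V) : x ∈ KW ↔ x ∈ W ∧ ∀ y ∈ W, ω x y = 0 := by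
    subst hKW
    simp [LinearMap.ext_iff, and_comm]
  by_cases hKW' : K ≤ W
  · have hle : K ≤ KW := fun x hx ↦ by
      refine (hmem x).2 ⟨hKW' hx, fun y _ ↦ ?_⟩
      rw [hK, LinearMap.mem_ker] at hx
      simp [hx]
    have horth : KW = LinearMap.BilinForm.orthogonal ω W := by
      ext x
      rw [hmem, LinearMap.BilinForm.mem_orthogonal_iff]
      refine ⟨fun h y hy ↦ hω.isRefl _ _ (h.2 y hy), fun h ↦ ?_⟩
      have hx (y : V) (hy : y ∈ W) : ω x y = 0 := hω.isRefl _ _ (h y hy)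
      refine ⟨by_contra fun hxW ↦ hxW (hKW' ?_), hx⟩
      rw [hK]
      exact mem_ker_of_forall_mem_eq_zero ω hW hxW hx (halt x)
    have hdim := LinearMap.BilinForm.finrank_add_finrank_orthogonal (B := ω) hω.isRefl W
    rw [LinearMap.BilinForm.orthogonal_top_eq_ker hω.isRefl, ← hK, ← horth,
      inf_eq_right.2 hKW'] at hdim
    exact ⟨Or.inl ⟨⟨hKW', hle, by omega⟩, fun h ↦ h.1 hKW'⟩, Or.inl hle⟩
  · obtain ⟨k, hkK, hkW⟩ := SetLike.not_le_iff_exists.1 hKW'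
    have hk : ω k = 0 := by rwa [hK, LinearMap.mem_ker] at hkK
    have heq : KW = K ⊓ W := by
      ext x
      rw [hmem, Submodule.mem_inf, and_comm]
      refine and_congr_left fun _ ↦ ⟨fun hx ↦ ?_, fun hx y _ ↦ ?_⟩
      · rw [hK]
        exact mem_ker_of_forall_mem_eq_zero ω hW hkW hx (hω.isRefl _ _ (by simp [hk]))
      · rw [hK, LinearMap.mem_ker] at hx
        simp [hx]
    have hsup : K ⊔ W = ⊤ := by
      rw [eq_top_iff, ← sup_span_singleton_eq_top_of_finrank_add_one hW hkW, sup_comm K]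
      exact sup_le_sup_left ((Submodule.span_singleton_le_iff_mem _ _).2 hkK) _
    have hdim := Submodule.finrank_sup_add_finrank_inf_eq K W
    rw [hsup, finrank_top, ← heq] at hdim
    exact ⟨Or.inr ⟨⟨hKW', heq, by omega⟩, fun h ↦ hKW' h.1⟩, Or.inr (heq.trans_le inf_le_left)⟩
end

section
/- Let g be a finite-dimensional real Lie algebra, ω a closed 2-form on g, and W a Lie ideal of g such that ker ω ⊆ W. Then ker ω is a Lie ideal of the Lie subalgebra ker(ω|_W); if moreover W has codimension 1 in g, then ker ω has codimension 1 in ker(ω|_W). -/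
open Module

/-- If the kernel of an alternating form lies in a hyperplane, then so does the orthogonal
complement of that hyperplane. -/
theorem LinearMap.BilinForm.IsAlt.orthogonal_le_of_ker_le {K V : Type*} [Field K]
    [AddCommGroup V] [Module K V] [FiniteDimensional K V] {B : LinearMap.BilinForm K V}
    (hB : B.IsAlt) {W : Submodule K V} (hW : finrank K W + 1 = finrank K V)
    (hker : LinearMap.ker B ≤ W) : B.orthogonal W ≤ W := by
  intro x hx
  by_contra hxW
  have htop : W ⊔ K ∙ x = ⊤ := by
    refine Submodule.eq_top_of_finrank_eq (le_antisymm (Submodule.finrank_le _) ?_)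
    rw [← hW]
    refine Nat.succ_le_of_lt (Submodule.finrank_lt_finrank_of_lt (lt_of_le_of_ne le_sup_left ?_))
    intro h
    exact hxW (h ▸ Submodule.mem_sup_right (Submodule.mem_span_singleton_self x))
  refine hxW (hker (LinearMap.mem_ker.2 (LinearMap.ext fun z => ?_)))
  obtain ⟨w, hw, y, hy, rfl⟩ := Submodule.mem_sup.1 (htop ▸ Submodule.mem_top : z ∈ W ⊔ K ∙ x)
  obtain ⟨c, rfl⟩ := Submodule.mem_span_singleton.1 hy
  have hxw : B x w = 0 := hB.isRefl w x (hx w hw)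
  simp [hxw, hB.self_eq_zero x]

/-- If the kernel of a bilinear form lies in a hyperplane, then the orthogonal complement of that
hyperplane has dimension one more than the kernel. -/
theorem LinearMap.BilinForm.finrank_ker_add_one {K V : Type*} [Field K]
    [AddCommGroup V] [Module K V] [FiniteDimensional K V] {B : LinearMap.BilinForm K V}
    {W : Submodule K V} (hW : finrank K W + 1 = finrank K V) (hker : LinearMap.ker B ≤ W) :
    finrank K (LinearMap.ker B) + 1 = finrank K (B.orthogonal W) := by
  have h := LinearMap.BilinForm.finrank_add_finrank_orthogonal' (B := B) W
  rw [inf_eq_right.2 hker] at h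
  omega

/-- If W is a Lie ideal of g containing the kernel of a closed 2-form ω, then
ker ω is a Lie ideal of the Lie subalgebra ker(ω|_W); if moreover W has
codimension 1 in g, then ker ω has codimension 1 in ker(ω|_W). -/
theorem kernel_is_ideal_of_kernel_of_restriction
    {g : Type*} [LieRing g] [LieAlgebra ℝ g] [Module.Finite ℝ g]
    (ω : g →ₗ[ℝ] g →ₗ[ℝ] ℝ)
    (halt : ∀ x : g, ω x x = 0)
    (hclosed : ∀ x y z : g, ω ⁅x, y⁆ z + ω ⁅y, z⁆ x + ω ⁅z, x⁆ y = 0)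
    (W : LieIdeal ℝ g)
    (hker : LinearMap.ker ω ≤ LieSubmodule.toSubmodule W)
    (KW : Submodule ℝ g)
    (hKW : KW = LieSubmodule.toSubmodule W ⊓
        LinearMap.ker (ω.compl₂ (LieSubmodule.toSubmodule W).subtype)) :
    (∀ x ∈ KW, ∀ y ∈ KW, ⁅x, y⁆ ∈ KW) ∧
    LinearMap.ker ω ≤ KW ∧
    (∀ x ∈ KW, ∀ y ∈ LinearMap.ker ω, ⁅x, y⁆ ∈ LinearMap.ker ω) ∧
    (finrank ℝ W + 1 = finrank ℝ g →
      finrank ℝ (LinearMap.ker ω) + 1 = finrank ℝ KW) := by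
  have hB : LinearMap.BilinForm.IsAlt ω := halt
  have hskew : ∀ x y, ω x y = 0 → ω y x = 0 := hB.isRefl
  have hmem : ∀ x, x ∈ KW ↔ x ∈ W ∧ ∀ w ∈ W, ω x w = 0 := by
    intro x
    simp [hKW, LinearMap.ext_iff]
  refine ⟨fun x hx y hy => ?_, fun x hx => ?_, fun x hx y hy => ?_, fun hW => ?_⟩
  · rw [hmem] at hx hy ⊢
    refine ⟨lie_mem_right ℝ g W x y hy.1, fun w hw => ?_⟩
    have h₁ := hskew _ _ (hx.2 ⁅y, w⁆ (lie_mem_right ℝ g W y w hw))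
    have h₂ := hskew _ _ (hy.2 ⁅w, x⁆ (lie_mem_right ℝ g W w x hx.1))
    linarith [hclosed x y w]
  · rw [hmem]
    exact ⟨hker hx, fun w _ => by rw [LinearMap.mem_ker.1 hx, LinearMap.zero_apply]⟩
  · rw [hmem] at hx
    refine LinearMap.mem_ker.2 (LinearMap.ext fun z => ?_)
    have h₁ := hskew _ _ (hx.2 ⁅y, z⁆ (lie_mem_left ℝ g W y z (hker hy)))
    have h₂ := hskew y ⁅z, x⁆ (by rw [LinearMap.mem_ker.1 hy, LinearMap.zero_apply])
    rw [LinearMap.zero_apply]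
    linarith [hclosed x y z]
  · have hKW_eq : KW = LinearMap.BilinForm.orthogonal ω (LieSubmodule.toSubmodule W) := by
      ext x
      rw [hmem]
      exact ⟨fun hx w hw => hskew _ _ (hx.2 w hw), fun hx =>
        ⟨hB.orthogonal_le_of_ker_le hW hker hx, fun w hw => hskew _ _ (hx w hw)⟩⟩
    rw [hKW_eq]
    exact LinearMap.BilinForm.finrank_ker_add_one hW hker
end

section
/- Let g be a real Lie algebra and ω a closed 2-form on g. If x and y both lie in the ω-orthogonal of the derived ideal [g,g], then [x,y] ∈ ker ω. In particular, if ω is nondegenerate, then the ω-orthogonal of [g,g] is an abelian Lie subalgebra of g. -/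
open Module

/-- For a closed 2-form ω on a real Lie algebra g, the bracket of two elements
of the ω-orthogonal of the derived ideal [g,g] lies in ker ω; in particular, if
ω is nondegenerate, this orthogonal is an abelian Lie subalgebra of g. -/
theorem orthogonal_of_derived_ideal_bracket_in_kernel
    {g : Type*} [LieRing g] [LieAlgebra ℝ g]
    (ω : g →ₗ[ℝ] g →ₗ[ℝ] ℝ)
    (halt : ∀ x : g, ω x x = 0)
    (hclosed : ∀ x y z : g, ω ⁅x, y⁆ z + ω ⁅y, z⁆ x + ω ⁅z, x⁆ y = 0) :
    (∀ x y : g,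
      (∀ z ∈ LieAlgebra.derivedSeries ℝ g 1, ω x z = 0) →
      (∀ z ∈ LieAlgebra.derivedSeries ℝ g 1, ω y z = 0) →
      ∀ z : g, ω ⁅x, y⁆ z = 0) ∧
    ((∀ ξ : g, (∀ η : g, ω ξ η = 0) → ξ = 0) →
      ∃ A : LieSubalgebra ℝ g,
        (A : Set g) = {x : g | ∀ z ∈ LieAlgebra.derivedSeries ℝ g 1, ω x z = 0} ∧
        ∀ x ∈ A, ∀ y ∈ A, ⁅x, y⁆ = 0) := by
  have hmem : ∀ a b : g, ⁅a, b⁆ ∈ LieAlgebra.derivedSeries ℝ g 1 := fun a b => by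
    rw [LieAlgebra.derivedSeries_def, LieAlgebra.derivedSeriesOfIdeal_succ,
      LieAlgebra.derivedSeriesOfIdeal_zero]
    exact LieSubmodule.lie_mem_lie (LieSubmodule.mem_top a) (LieSubmodule.mem_top b)
  have hskew : ∀ a b : g, -ω a b = ω b a := LinearMap.IsAlt.neg (B := ω) halt
  have hker : ∀ x y : g,
      (∀ z ∈ LieAlgebra.derivedSeries ℝ g 1, ω x z = 0) →
      (∀ z ∈ LieAlgebra.derivedSeries ℝ g 1, ω y z = 0) →
      ∀ z : g, ω ⁅x, y⁆ z = 0 := fun x y hx hy z => by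
    linarith [hclosed x y z, hskew x ⁅y, z⁆, hskew y ⁅z, x⁆,
      hx _ (hmem y z), hy _ (hmem z x)]
  refine ⟨hker, fun hnondeg => ?_⟩
  have habel : ∀ x y : g,
      (∀ z ∈ LieAlgebra.derivedSeries ℝ g 1, ω x z = 0) →
      (∀ z ∈ LieAlgebra.derivedSeries ℝ g 1, ω y z = 0) → ⁅x, y⁆ = 0 :=
    fun x y hx hy => hnondeg _ (hker x y hx hy)
  refine ⟨{ carrier := {x : g | ∀ z ∈ LieAlgebra.derivedSeries ℝ g 1, ω x z = 0}
            add_mem' := fun {a b} ha hb z hz => by simp [ha z hz, hb z hz]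
            zero_mem' := fun z _ => by simp
            smul_mem' := fun c a ha z hz => by simp [ha z hz]
            lie_mem' := fun {a b} ha hb z _ => hker a b ha hb z }, rfl, ?_⟩
  exact fun x hx y hy => habel x y hx hy
end

section
/- Let g be a finite-dimensional real Lie algebra, ω a closed 2-form on g, and I a Lie ideal of g such that the restriction ω|_I is nondegenerate. Then g = I ⊕ I^⊥ as a direct sum of vector spaces, where I^⊥ = {x ∈ g : ω(x, y) = 0 for all y ∈ I} is a Lie subalgebra of g; thus g is the semidirect product of the subalgebra I^⊥ acting on the ideal I, and ω decomposes as ω = ω|_I + ω|_{I^⊥} with respect to this decomposition. -/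
open Module

/-- The orthogonal of a Lie ideal with respect to a closed 2-form is closed under the bracket. -/
theorem lie_orthogonal_of_closed {R g : Type*} [CommRing R] [LieRing g] [LieAlgebra R g]
    {ω : g →ₗ[R] g →ₗ[R] R}
    (hclosed : ∀ x y z : g, ω ⁅x, y⁆ z + ω ⁅y, z⁆ x + ω ⁅z, x⁆ y = 0)
    (halt : ω.IsAlt) (I : LieIdeal R g) {x y : g}
    (hx : ∀ z ∈ I, ω x z = 0) (hy : ∀ z ∈ I, ω y z = 0) : ∀ z ∈ I, ω ⁅x, y⁆ z = 0 := by
  intro z hz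
  have h₁ : ω ⁅y, z⁆ x = 0 := halt.isRefl _ _ (hx _ (lie_mem_right R g I y z hz))
  have h₂ : ω ⁅z, x⁆ y = 0 := halt.isRefl _ _ (hy _ (lie_mem_left R g I z x hz))
  simpa [h₁, h₂] using hclosed x y z

/-- If a closed 2-form ω on a finite-dimensional real Lie algebra g restricts
nondegenerately to a Lie ideal I, then g = I ⊕ I^⊥, the ω-orthogonal I^⊥ is a
Lie subalgebra (so g is the semidirect product of I^⊥ acting on I), and ω
decomposes as ω|_I + ω|_{I^⊥}. -/
theorem symplectic_ideal_gives_semidirect_decomposition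
    {g : Type*} [LieRing g] [LieAlgebra ℝ g] [Module.Finite ℝ g]
    (ω : g →ₗ[ℝ] g →ₗ[ℝ] ℝ)
    (halt : ∀ x : g, ω x x = 0)
    (hclosed : ∀ x y z : g, ω ⁅x, y⁆ z + ω ⁅y, z⁆ x + ω ⁅z, x⁆ y = 0)
    (I : LieIdeal ℝ g)
    (hnd : ∀ x ∈ I, (∀ y ∈ I, ω x y = 0) → x = 0)
    (P : Submodule ℝ g)
    (hP : P = LinearMap.ker (ω.compl₂ (LieSubmodule.toSubmodule I).subtype)) :
    (∀ x ∈ P, ∀ y ∈ P, ⁅x, y⁆ ∈ P) ∧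
    LieSubmodule.toSubmodule I ⊓ P = ⊥ ∧
    LieSubmodule.toSubmodule I ⊔ P = ⊤ ∧
    (∀ a ∈ I, ∀ b ∈ I, ∀ s ∈ P, ∀ t ∈ P,
      ω (a + s) (b + t) = ω a b + ω s t) := by
  have alt : ω.IsAlt := halt
  have mem_P {x : g} : x ∈ P ↔ ∀ y ∈ I, ω x y = 0 := by
    simp [hP, LinearMap.ext_iff]
  have orthogonal_eq : LinearMap.BilinForm.orthogonal ω (LieSubmodule.toSubmodule I) = P := by
    ext x
    exact ⟨fun h => mem_P.2 fun y hy => alt.isRefl _ _ (h y hy),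
      fun h y hy => alt.isRefl _ _ (mem_P.1 h y hy)⟩
  have nondegenerate :
      (LinearMap.BilinForm.restrict ω (LieSubmodule.toSubmodule I)).Nondegenerate := by
    refine ⟨fun x hx => Subtype.ext (hnd x x.2 fun y hy => hx ⟨y, hy⟩),
      fun x hx => Subtype.ext (hnd x x.2 fun y hy => alt.isRefl _ _ (hx ⟨y, hy⟩))⟩
  have compl : IsCompl (LieSubmodule.toSubmodule I) P :=
    orthogonal_eq ▸
      LinearMap.BilinForm.isCompl_orthogonal_of_restrict_nondegenerate alt.isRefl nondegenerate
  refine ⟨fun x hx y hy =>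
    mem_P.2 (lie_orthogonal_of_closed hclosed alt I (mem_P.1 hx) (mem_P.1 hy)),
    compl.inf_eq_bot, compl.sup_eq_top, fun a ha b hb s hs t ht => ?_⟩
  simp [mem_P.1 hs b hb, alt.isRefl _ _ (mem_P.1 ht a ha)]
end
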